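/- Duality formula for k pairs of characteristic polynomials in the complex Ginibre ensemble: let N, k ≥ 1 and z_1, …, z_k, w_1, …, w_k ∈ ℂ. Then ∫ exp(−Tr(J Jᴴ)) · ∏_{j=1}^{k} det(z_j·I_N − J) · det(conj(w_j)·I_N − Jᴴ) dJ = π^{N²} · (N/π)^{k²} · ∫ exp(−N·Tr(A Aᴴ)) · det(M(A))^N dA, where the left integral is over all N×N complex matrices J, the right integral is over all k×k complex matrices A, and M(A) is the 2k×2k block matrix [[Z, i√N·Aᴴ],[i√N·A, W]] with Z = diag(z_1,…,z_k) and W = diag(conj(w_1),…,conj(w_k)). -/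

import Mathlib

open MeasureTheory Matrix Finset

/-- The moment `𝔼 x ^ a * conj x ^ b` of a centred complex Gaussian variable with variance `v`. -/
def gaussMoment (v : ℂ) (a b : ℕ) : ℂ := if a = b then v ^ a * a.factorial else 0

lemma gaussMoment_zero (a b : ℕ) : gaussMoment 0 a b = 0 ^ a * 0 ^ b := by
  unfold gaussMoment
  rcases Nat.eq_zero_or_pos a with rfl | ha
  · rcases Nat.eq_zero_or_pos b with rfl | hb
    · simp
    · simp [hb.ne', hb.ne]
  · simp [ha.ne']

lemma hasDerivAt_gaussMoment (a b : ℕ) {v : ℂ → ℂ} {v' t : ℂ} (hv : HasDerivAt v v' t) :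
    HasDerivAt (fun t => gaussMoment (v t) a b)
      (v' * (a * b * gaussMoment (v t) (a - 1) (b - 1))) t := by
  unfold gaussMoment
  by_cases h : a = b
  · subst h
    simp only [if_true]
    refine ((hv.pow a).mul_const (a.factorial : ℂ)).congr_deriv ?_
    cases a with
    | zero => simp
    | succ n => simp [Nat.factorial_succ]; ring
  · simp only [h, if_false]
    refine (hasDerivAt_const t (0 : ℂ)).congr_deriv ?_
    rcases a with _ | a
    · simp
    rcases b with _ | b
    · simp
    · have : a ≠ b := fun h' => h (by rw [h'])
      simp [this]

lemma integral_norm_pow_mul_exp_neg_norm_sq (n : ℕ) :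
    ∫ x : ℂ, ‖x‖ ^ n * Real.exp (-‖x‖ ^ 2) = Real.pi * Real.Gamma ((n + 2) / 2) := by
  have h := Complex.integral_rpow_mul_exp_neg_rpow (p := 2) (q := n) (by norm_num)
    (by have : (0 : ℝ) ≤ n := n.cast_nonneg
        linarith)
  norm_cast at h
  rw [h]
  push_cast
  ring

lemma integrable_gauss_monomial (a b : ℕ) :
    Integrable (fun x : ℂ => Complex.exp (-(x * star x)) * (x ^ a * star x ^ b)) := by
  have h : Integrable (fun x : ℂ => ‖x‖ ^ (a + b) * Real.exp (-‖x‖ ^ 2)) := by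
    apply Integrable.of_integral_ne_zero
    rw [integral_norm_pow_mul_exp_neg_norm_sq]
    have : 0 < Real.Gamma (((a + b : ℕ) + 2) / 2) := Real.Gamma_pos_of_pos (by positivity)
    positivity
  refine h.mono' (by fun_prop) (ae_of_all _ fun x => le_of_eq ?_)
  have : -(x * star x) = ((-‖x‖ ^ 2 : ℝ) : ℂ) := by
    simp [Complex.mul_conj, Complex.normSq_eq_norm_sq]
  rw [norm_mul, this, Complex.norm_exp_ofReal, norm_mul, norm_pow, norm_pow, norm_star, pow_add]
  ring

lemma integral_gauss_monomial (a b : ℕ) :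
    ∫ x : ℂ, Complex.exp (-(x * star x)) * (x ^ a * star x ^ b) =
      Real.pi * gaussMoment 1 a b := by
  unfold gaussMoment
  by_cases h : a = b
  · subst h
    have h1 := integral_norm_pow_mul_exp_neg_norm_sq (2 * a)
    have h2 : Real.Gamma (((2 * a : ℕ) + 2) / 2) = a.factorial := by
      rw [← Real.Gamma_nat_eq_factorial]
      congr 1
      push_cast
      ring
    rw [h2] at h1
    have h3 := congrArg (fun r : ℝ => (r : ℂ)) h1
    simp only [if_true, one_pow, one_mul]
    push_cast [← integral_complex_ofReal] at h3
    rw [← h3]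
    refine integral_congr_ae (ae_of_all _ fun x => ?_)
    have : x * star x = (‖x‖ : ℂ) ^ 2 := by
      simp [Complex.mul_conj, Complex.normSq_eq_norm_sq]
    simp only [← mul_pow]
    rw [this]
    ring
  · simp only [h, if_false, mul_zero]
    have hab : (a : ℝ) - b ≠ 0 := sub_ne_zero.2 (by exact_mod_cast h)
    set θ : ℝ := Real.pi / (a - b)
    set c : Circle := Circle.exp θ
    have hc : (c : ℂ) ^ a * star (c : ℂ) ^ b = -1 := by
      have h1 : (c : ℂ) = Complex.exp (θ * Complex.I) := Circle.coe_exp θ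
      have h2 : star (c : ℂ) = Complex.exp (-(θ * Complex.I)) := by
        rw [h1, ← starRingEnd_apply, ← Complex.exp_conj]
        simp
      rw [h2, h1, ← Complex.exp_nat_mul, ← Complex.exp_nat_mul, ← Complex.exp_add,
        ← Complex.exp_pi_mul_I]
      congr 1
      have : (θ : ℂ) * (a - b) = Real.pi := by
        have : θ * (a - b) = Real.pi := div_mul_cancel₀ _ hab
        exact_mod_cast this
      rw [← this]
      ring
    have hcc : (c : ℂ) * star (c : ℂ) = 1 := by
      rw [← starRingEnd_apply, Complex.mul_conj, Complex.normSq_eq_norm_sq, Circle.norm_coe]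
      simp
    have key := (rotation c).measurePreserving.integral_comp
      (rotation c).toHomeomorph.measurableEmbedding
      (fun x : ℂ => Complex.exp (-(x * star x)) * (x ^ a * star x ^ b))
    have h4 : ∀ x : ℂ, Complex.exp (-(rotation c x * star (rotation c x))) *
        (rotation c x ^ a * star (rotation c x) ^ b) =
        -1 * (Complex.exp (-(x * star x)) * (x ^ a * star x ^ b)) := by
      intro x
      rw [rotation_apply, star_mul', mul_mul_mul_comm, hcc, one_mul, ← hc]
      ring
    simp only [h4, integral_const_mul] at key
    linear_combination (-1 / 2 : ℂ) * key

/-- Products of one-variable Gaussian monomials, over a matrix of independent entries. -/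
lemma integrable_matrix_gauss_monomial {α β : Type*} [Fintype α] [Fintype β] (p q : α → β → ℕ) :
    Integrable (fun J : α → β → ℂ => ∏ a, ∏ b,
      (Complex.exp (-(J a b * star (J a b))) * (J a b ^ p a b * star (J a b) ^ q a b))) := by
  refine Integrable.fintype_prod_dep (f := fun a (r : β → ℂ) => ∏ b,
      (Complex.exp (-(r b * star (r b))) * (r b ^ p a b * star (r b) ^ q a b))) fun a => ?_
  exact Integrable.fintype_prod_dep (f := fun b (x : ℂ) =>
      (Complex.exp (-(x * star x)) * (x ^ p a b * star x ^ q a b))) fun b =>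
        integrable_gauss_monomial _ _

lemma integral_matrix_gauss_monomial {α β : Type*} [Fintype α] [Fintype β] (p q : α → β → ℕ) :
    ∫ J : α → β → ℂ, ∏ a, ∏ b,
      (Complex.exp (-(J a b * star (J a b))) * (J a b ^ p a b * star (J a b) ^ q a b)) =
    (Real.pi : ℂ) ^ (Fintype.card α * Fintype.card β) *
      ∏ a, ∏ b, gaussMoment 1 (p a b) (q a b) := by
  rw [integral_fintype_prod_volume_eq_prod (fun a (r : β → ℂ) => ∏ b,
      (Complex.exp (-(r b * star (r b))) * (r b ^ p a b * star (r b) ^ q a b)))]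
  have h : ∀ a, ∫ r : β → ℂ, ∏ b,
      (Complex.exp (-(r b * star (r b))) * (r b ^ p a b * star (r b) ^ q a b)) =
      (Real.pi : ℂ) ^ Fintype.card β * ∏ b, gaussMoment 1 (p a b) (q a b) := by
    intro a
    rw [integral_fintype_prod_volume_eq_prod (fun b (x : ℂ) =>
      (Complex.exp (-(x * star x)) * (x ^ p a b * star x ^ q a b)))]
    simp only [integral_gauss_monomial]
    rw [prod_mul_distrib, prod_const, card_univ]
  simp only [h]
  rw [prod_mul_distrib, prod_const, card_univ, ← pow_mul, mul_comm (Fintype.card α)]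

/-- Leibniz rule for a finite product. -/
lemma derivation_prod {R A ι : Type*} [CommRing R] [CommRing A] [Algebra R A] [DecidableEq ι]
    (D : Derivation R A A) (s : Finset ι) (f : ι → A) :
    D (∏ i ∈ s, f i) = ∑ i ∈ s, (∏ j ∈ s.erase i, f j) * D (f i) := by
  induction s using Finset.induction_on with
  | empty => simp
  | insert i s hi ih =>
    rw [prod_insert hi, D.leibniz, ih, sum_insert hi, erase_insert hi, smul_eq_mul, smul_eq_mul,
      mul_sum, add_comm]
    congr 1
    refine sum_congr rfl fun j hj => ?_
    have hij : i ≠ j := fun h => hi (h ▸ hj)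
    rw [erase_insert_of_ne hij, prod_insert (fun h => hi (mem_of_mem_erase h)), mul_assoc]

/-- Second-order Leibniz rule for a product whose factors are killed by `D ∘ D'`. -/
lemma derivation_derivation_prod {R A ι : Type*} [CommRing R] [CommRing A] [Algebra R A]
    [DecidableEq ι] (D D' : Derivation R A A) (s : Finset ι) (f : ι → A)
    (hf : ∀ i, D (D' (f i)) = 0) :
    D (D' (∏ i ∈ s, f i)) = ∑ i ∈ s, ∑ j ∈ s.erase i,
      (∏ l ∈ (s.erase i).erase j, f l) * (D (f j) * D' (f i)) := by
  rw [derivation_prod, map_sum]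
  refine sum_congr rfl fun i _ => ?_
  rw [D.leibniz, hf, smul_zero, zero_add, derivation_prod, smul_eq_mul, mul_sum]
  exact sum_congr rfl fun j _ => by ring

/-- Expansion of a second-order differential operator applied to a determinant. -/
lemma sum_derivation_det {R A n ι : Type*} [CommRing R] [CommRing A] [Algebra R A]
    [Fintype n] [DecidableEq n] [Fintype ι] (D D' : ι → Derivation R A A) (M : Matrix n n A)
    (hD : ∀ s p q, D s (D' s (M p q)) = 0) :
    ∑ i, D i (D' i M.det) =
      ∑ x, ∑ y ∈ univ.erase x, ∑ σ : Equiv.Perm n, Equiv.Perm.sign σ •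
        ((∏ l ∈ (univ.erase x).erase y, M (σ l) l) *
          ∑ i, D i (M (σ y) y) * D' i (M (σ x) x)) := by
  have : ∀ i, D i (D' i M.det) = ∑ x, ∑ y ∈ univ.erase x, ∑ σ : Equiv.Perm n,
      Equiv.Perm.sign σ • ((∏ l ∈ (univ.erase x).erase y, M (σ l) l) *
        (D i (M (σ y) y) * D' i (M (σ x) x))) := by
    intro i
    rw [det_apply, map_sum, map_sum]
    simp only [Units.smul_def, map_zsmul]
    simp only [derivation_derivation_prod _ _ _ _ (fun l => hD i _ l), smul_sum]
    rw [sum_comm]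
    exact sum_congr rfl fun x _ => sum_comm
  simp only [this, mul_sum, smul_sum]
  rw [sum_comm]
  refine sum_congr rfl fun x _ => ?_
  rw [sum_comm]
  exact sum_congr rfl fun y _ => sum_comm

/-- Two families of second-order differential operators whose symbols differ by the exchange of two
columns act on a determinant in the same way. -/
lemma sum_derivation_det_eq {R A n ι κ : Type*} [CommRing R] [CommRing A] [Algebra R A]
    [Fintype n] [DecidableEq n] [Fintype ι] [Fintype κ]
    (D D' : ι → Derivation R A A) (E E' : κ → Derivation R A A) (M : Matrix n n A)
    (hD : ∀ s p q, D s (D' s (M p q)) = 0) (hE : ∀ s p q, E s (E' s (M p q)) = 0)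
    (h : ∀ p q r s, ∑ i, D i (M p q) * D' i (M r s) = -∑ i, E i (M r q) * E' i (M p s)) :
    ∑ i, D i (D' i M.det) = ∑ i, E i (E' i M.det) := by
  rw [sum_derivation_det D D' M hD, sum_derivation_det E E' M hE]
  refine sum_congr rfl fun x _ => sum_congr rfl fun y hy => ?_
  have hxy : y ≠ x := ne_of_mem_erase hy
  rw [← Equiv.sum_comp (Equiv.mulRight (Equiv.swap x y))]
  refine sum_congr rfl fun σ _ => ?_
  have hprod : ∏ l ∈ (univ.erase x).erase y, M ((σ * Equiv.swap x y) l) l =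
      ∏ l ∈ (univ.erase x).erase y, M (σ l) l := by
    refine prod_congr rfl fun l hl => ?_
    rw [Equiv.Perm.mul_apply, Equiv.swap_apply_of_ne_of_ne
      (ne_of_mem_erase (mem_of_mem_erase hl)) (ne_of_mem_erase hl)]
  simp only [Equiv.coe_mulRight, hprod]
  simp only [Equiv.Perm.mul_apply, Equiv.swap_apply_left, Equiv.swap_apply_right, h,
    Equiv.Perm.sign_mul, Equiv.Perm.sign_swap hxy.symm]
  simp

open MvPolynomial in
/-- The Gaussian expectation of polynomials in independent complex variables and their conjugates,
the variable `s` having variance `v s`. -/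
noncomputable def gaussExp {τ : Type*} [Fintype τ] (v : τ → ℂ) :
    MvPolynomial (τ ⊕ τ) ℂ →ₗ[ℂ] ℂ :=
  (basisMonomials (τ ⊕ τ) ℂ).constr ℂ
    (fun m => ∏ s, gaussMoment (v s) (m (Sum.inl s)) (m (Sum.inr s)))

lemma gaussExp_monomial {τ : Type*} [Fintype τ] (v : τ → ℂ) (m : τ ⊕ τ →₀ ℕ) (c : ℂ) :
    gaussExp v (MvPolynomial.monomial m c) =
      c * ∏ s, gaussMoment (v s) (m (Sum.inl s)) (m (Sum.inr s)) := by
  have h : MvPolynomial.monomial m c = c • MvPolynomial.basisMonomials (τ ⊕ τ) ℂ m := by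
    simp [MvPolynomial.coe_basisMonomials, MvPolynomial.smul_monomial]
  rw [h, map_smul, gaussExp, Module.Basis.constr_basis, smul_eq_mul]

/-- Heat equation: varying the variances amounts to applying a Laplacian. -/
lemma hasDerivAt_gaussExp {τ : Type*} [Fintype τ] [DecidableEq τ] (v : ℂ → τ → ℂ) (v' : τ → ℂ)
    (t : ℂ) (hv : ∀ s, HasDerivAt (fun t => v t s) (v' s) t) (P : MvPolynomial (τ ⊕ τ) ℂ) :
    HasDerivAt (fun t => gaussExp (v t) P)
      (∑ s, v' s * gaussExp (v t)
        (MvPolynomial.pderiv (Sum.inl s) (MvPolynomial.pderiv (Sum.inr s) P))) t := by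
  induction P using MvPolynomial.induction_on' with
  | add p q hp hq =>
    simp only [map_add, mul_add, sum_add_distrib]
    exact hp.add hq
  | monomial m c =>
    simp only [gaussExp_monomial, MvPolynomial.pderiv_monomial]
    refine ((HasDerivAt.fun_finsetProd fun s (_ : s ∈ univ) =>
      hasDerivAt_gaussMoment (m (Sum.inl s)) (m (Sum.inr s)) (hv s)).const_mul c).congr_deriv ?_
    rw [mul_sum]
    refine sum_congr rfl fun s _ => ?_
    rw [← mul_prod_erase univ _ (mem_univ s)]
    have h : ∀ r ∈ univ.erase s, gaussMoment (v t r)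
        ((m - Finsupp.single (Sum.inr s) 1 - Finsupp.single (Sum.inl s) 1 : τ ⊕ τ →₀ ℕ) (Sum.inl r))
        ((m - Finsupp.single (Sum.inr s) 1 - Finsupp.single (Sum.inl s) 1 : τ ⊕ τ →₀ ℕ) (Sum.inr r)) =
        gaussMoment (v t r) (m (Sum.inl r)) (m (Sum.inr r)) := by
      intro r hr
      have hrs : s ≠ r := (ne_of_mem_erase hr).symm
      simp [hrs]
    rw [prod_congr rfl h]
    simp
    ring

/-- Two blocks of variables whose Laplacians agree on `P` give the same Gaussian expectation. -/
lemma gaussExp_eq_of_laplacian_eq {σ ρ : Type*} [Fintype σ] [Fintype ρ] [DecidableEq σ]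
    [DecidableEq ρ] (P : MvPolynomial ((σ ⊕ ρ) ⊕ (σ ⊕ ρ)) ℂ)
    (h : ∑ s : σ, MvPolynomial.pderiv (Sum.inl (Sum.inl s))
        (MvPolynomial.pderiv (Sum.inr (Sum.inl s)) P) =
      ∑ s : ρ, MvPolynomial.pderiv (Sum.inl (Sum.inr s))
        (MvPolynomial.pderiv (Sum.inr (Sum.inr s)) P)) :
    gaussExp (Sum.elim 1 0) P = gaussExp (Sum.elim 0 1) P := by
  let v : ℂ → σ ⊕ ρ → ℂ := fun t => Sum.elim (fun _ => t) (fun _ => 1 - t)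
  have hv : ∀ t, HasDerivAt (fun t => gaussExp (v t) P) 0 t := by
    intro t
    refine (hasDerivAt_gaussExp v (Sum.elim (fun _ => 1) (fun _ => -1)) t ?_ P).congr_deriv ?_
    · rintro (s | s)
      · exact hasDerivAt_id t
      · exact (hasDerivAt_id t).const_sub 1
    · simp only [Fintype.sum_sum_type, Sum.elim_inl, Sum.elim_inr, one_mul, neg_mul,
        sum_neg_distrib, ← map_sum, h]
      ring
  have := is_const_of_deriv_eq_zero (fun t => (hv t).differentiableAt) (fun t => (hv t).deriv) 1 0
  have h1 : v 1 = Sum.elim (1 : σ → ℂ) (0 : ρ → ℂ) := by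
    ext (s | s) <;> simp [v]
  have h0 : v 0 = Sum.elim (0 : σ → ℂ) (1 : ρ → ℂ) := by
    ext (s | s) <;> simp [v]
  rwa [h1, h0] at this

/-- The integral of a polynomial in the entries of a matrix and their conjugates, the other
variables being set to zero. -/
lemma integral_eval_eq_gaussExp {α β ρ τ : Type*} [Fintype α] [Fintype β] [Fintype ρ]
    [Fintype τ] (E : (α × β) ⊕ ρ ≃ τ) (P : MvPolynomial (τ ⊕ τ) ℂ) :
    ∫ J : α → β → ℂ, Complex.exp (-∑ a, ∑ b, J a b * star (J a b)) *
      MvPolynomial.eval (Sum.elim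
        (fun s => Sum.elim (fun x : α × β => J x.1 x.2) 0 (E.symm s))
        (fun s => Sum.elim (fun x : α × β => star (J x.1 x.2)) 0 (E.symm s))) P =
    (Real.pi : ℂ) ^ (Fintype.card α * Fintype.card β) *
      gaussExp (fun s => Sum.elim 1 0 (E.symm s)) P := by
  set pt : (α → β → ℂ) → τ ⊕ τ → ℂ := fun J => Sum.elim
        (fun s => Sum.elim (fun x : α × β => J x.1 x.2) 0 (E.symm s))
        (fun s => Sum.elim (fun x : α × β => star (J x.1 x.2)) 0 (E.symm s)) with hpt
  have hmon : ∀ (J : α → β → ℂ) (m : τ ⊕ τ →₀ ℕ) (c : ℂ),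
      Complex.exp (-∑ a, ∑ b, J a b * star (J a b)) *
        MvPolynomial.eval (pt J) (MvPolynomial.monomial m c) =
      (c * ∏ r : ρ, gaussMoment 0 (m (Sum.inl (E (Sum.inr r)))) (m (Sum.inr (E (Sum.inr r))))) *
        ∏ a, ∏ b, (Complex.exp (-(J a b * star (J a b))) *
          (J a b ^ m (Sum.inl (E (Sum.inl (a, b)))) *
            star (J a b) ^ m (Sum.inr (E (Sum.inl (a, b)))))) := by
    intro J m c
    rw [MvPolynomial.eval_monomial, Finsupp.prod_fintype _ _ (fun _ => pow_zero _),
      Fintype.prod_sum_type]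
    simp only [hpt, Sum.elim_inl, Sum.elim_inr]
    rw [← E.prod_comp, ← E.prod_comp, Fintype.prod_sum_type, Fintype.prod_sum_type]
    simp only [Equiv.symm_apply_apply, Sum.elim_inl, Sum.elim_inr, gaussMoment_zero,
      Fintype.prod_prod_type, prod_mul_distrib, Pi.zero_apply, ← sum_neg_distrib, Complex.exp_sum]
    ring
  have hint : ∀ m c, Integrable (fun J : α → β → ℂ =>
      Complex.exp (-∑ a, ∑ b, J a b * star (J a b)) *
        MvPolynomial.eval (pt J) (MvPolynomial.monomial m c)) := by
    intro m c
    simp only [hmon]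
    exact (integrable_matrix_gauss_monomial _ _).const_mul _
  rw [← P.support_sum_monomial_coeff]
  simp only [map_sum, mul_sum]
  rw [integral_finsetSum _ fun m _ => hint m _]
  refine sum_congr rfl fun m _ => ?_
  simp only [hmon]
  rw [integral_const_mul, integral_matrix_gauss_monomial
    (fun a b => m (Sum.inl (E (Sum.inl (a, b))))) (fun a b => m (Sum.inr (E (Sum.inl (a, b))))),
    gaussExp_monomial, ← E.prod_comp, Fintype.prod_sum_type]
  simp only [Equiv.symm_apply_apply, Sum.elim_inl, Sum.elim_inr, Fintype.prod_prod_type,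
    Pi.zero_apply, Pi.one_apply]
  ring

/-- A matrix, linear in the entries of a Gaussian `N × N` matrix `J` and of a Gaussian `k × k`
matrix `A`, which interpolates between the two sides of the duality. -/
noncomputable def dualMatrix {N k : ℕ} (z w : Fin k → ℂ) :
    Matrix (Fin N × (Fin k ⊕ Fin k)) (Fin N × (Fin k ⊕ Fin k))
      (MvPolynomial (((Fin N × Fin N) ⊕ (Fin k × Fin k)) ⊕ ((Fin N × Fin N) ⊕ (Fin k × Fin k))) ℂ)
  | (a, Sum.inl i), (b, Sum.inl j) => if i = j then
      MvPolynomial.C (if a = b then z i else 0) - MvPolynomial.X (Sum.inl (Sum.inl (a, b))) else 0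
  | (a, Sum.inl i), (b, Sum.inr j) => if a = b then
      MvPolynomial.C Complex.I * MvPolynomial.X (Sum.inr (Sum.inr (j, i))) else 0
  | (a, Sum.inr i), (b, Sum.inl j) => if a = b then
      MvPolynomial.C Complex.I * MvPolynomial.X (Sum.inl (Sum.inr (i, j))) else 0
  | (a, Sum.inr i), (b, Sum.inr j) => if i = j then
      MvPolynomial.C (if a = b then w i else 0) - MvPolynomial.X (Sum.inr (Sum.inl (b, a))) else 0

lemma dualMatrix_pderiv_pderiv {N k : ℕ} (z w : Fin k → ℂ)
    (x y : ((Fin N × Fin N) ⊕ (Fin k × Fin k)) ⊕ ((Fin N × Fin N) ⊕ (Fin k × Fin k)))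
    (p q : Fin N × (Fin k ⊕ Fin k)) :
    MvPolynomial.pderiv x (MvPolynomial.pderiv y (dualMatrix z w p q)) = 0 := by
  classical
  rcases p with ⟨a, i | i⟩ <;> rcases q with ⟨b, j | j⟩ <;> unfold dualMatrix <;> dsimp only <;>
    split_ifs <;> simp [MvPolynomial.pderiv_X, Pi.single_apply, apply_ite]

lemma dualMatrix_symbol {N k : ℕ} (z w : Fin k → ℂ) (p q r s : Fin N × (Fin k ⊕ Fin k)) :
    ∑ x : Fin N × Fin N, MvPolynomial.pderiv (Sum.inl (Sum.inl x)) (dualMatrix z w p q) *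
        MvPolynomial.pderiv (Sum.inr (Sum.inl x)) (dualMatrix z w r s) =
      -∑ x : Fin k × Fin k, MvPolynomial.pderiv (Sum.inl (Sum.inr x)) (dualMatrix z w r q) *
        MvPolynomial.pderiv (Sum.inr (Sum.inr x)) (dualMatrix z w p s) := by
  classical
  have I2 : (MvPolynomial.C Complex.I * MvPolynomial.C Complex.I :
      MvPolynomial (((Fin N × Fin N) ⊕ (Fin k × Fin k)) ⊕
        ((Fin N × Fin N) ⊕ (Fin k × Fin k))) ℂ) = -1 := by
    rw [← map_mul, Complex.I_mul_I, map_neg, map_one]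
  have ite0 : ∀ (c : Prop) [Decidable c] (y) (f : MvPolynomial (((Fin N × Fin N) ⊕
      (Fin k × Fin k)) ⊕ ((Fin N × Fin N) ⊕ (Fin k × Fin k))) ℂ),
      MvPolynomial.pderiv y (if c then f else 0) = if c then MvPolynomial.pderiv y f else 0 := by
    intro c _ y f
    split_ifs <;> simp
  rcases p with ⟨a, i | i⟩ <;> rcases q with ⟨b, j | j⟩ <;> rcases r with ⟨c, l | l⟩ <;>
    rcases s with ⟨d, h | h⟩ <;> simp only [dualMatrix, ite0] <;>
    simp [MvPolynomial.pderiv_X, Pi.single_apply]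
  rw [I2]
  grind

/-- The Laplacians in `J` and in `A` agree on the interpolating determinant. -/
lemma laplacian_det_dualMatrix {N k : ℕ} (z w : Fin k → ℂ) :
    ∑ s : Fin N × Fin N, MvPolynomial.pderiv (Sum.inl (Sum.inl s))
        (MvPolynomial.pderiv (Sum.inr (Sum.inl s)) (dualMatrix z w).det) =
      ∑ s : Fin k × Fin k, MvPolynomial.pderiv (Sum.inl (Sum.inr s))
        (MvPolynomial.pderiv (Sum.inr (Sum.inr s)) (dualMatrix z w).det) :=
  sum_derivation_det_eq
    (fun s : Fin N × Fin N => MvPolynomial.pderiv (Sum.inl (Sum.inl s)))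
    (fun s : Fin N × Fin N => MvPolynomial.pderiv (Sum.inr (Sum.inl s)))
    (fun s : Fin k × Fin k => MvPolynomial.pderiv (Sum.inl (Sum.inr s)))
    (fun s : Fin k × Fin k => MvPolynomial.pderiv (Sum.inr (Sum.inr s))) (dualMatrix z w)
    (fun _ _ _ => dualMatrix_pderiv_pderiv z w _ _ _ _)
    (fun _ _ _ => dualMatrix_pderiv_pderiv z w _ _ _ _) (dualMatrix_symbol z w)

lemma eval_det_dualMatrix_left {N k : ℕ} (z w : Fin k → ℂ) (J : Fin N → Fin N → ℂ) :
    MvPolynomial.eval (Sum.elim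
        (Sum.elim (fun x : Fin N × Fin N => J x.1 x.2) (0 : Fin k × Fin k → ℂ))
        (Sum.elim (fun x : Fin N × Fin N => star (J x.1 x.2)) (0 : Fin k × Fin k → ℂ)))
        (dualMatrix z w).det =
      ∏ j : Fin k, ((z j • (1 : Matrix (Fin N) (Fin N) ℂ) - Matrix.of J).det *
        (w j • (1 : Matrix (Fin N) (Fin N) ℂ) - (Matrix.of J)ᴴ).det) := by
  rw [RingHom.map_det, prod_mul_distrib]
  have h := Matrix.det_blockDiagonal (Sum.elim
    (fun j => z j • (1 : Matrix (Fin N) (Fin N) ℂ) - Matrix.of J)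
    (fun j => w j • (1 : Matrix (Fin N) (Fin N) ℂ) - (Matrix.of J)ᴴ))
  rw [Fintype.prod_sum_type] at h
  simp only [Sum.elim_inl, Sum.elim_inr] at h
  rw [← h]
  congr 1
  ext ⟨a, i | i⟩ ⟨b, j | j⟩ <;>
    simp only [RingHom.mapMatrix_apply, Matrix.map_apply, dualMatrix, blockDiagonal_apply] <;>
    split_ifs <;> simp_all

lemma eval_det_dualMatrix_right {N k : ℕ} (z w : Fin k → ℂ) (A : Fin k → Fin k → ℂ) :
    MvPolynomial.eval (Sum.elim
        (Sum.elim (0 : Fin N × Fin N → ℂ) (fun x : Fin k × Fin k => A x.1 x.2))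
        (Sum.elim (0 : Fin N × Fin N → ℂ) (fun x : Fin k × Fin k => star (A x.1 x.2))))
        (dualMatrix z w).det =
      (Matrix.fromBlocks (Matrix.diagonal z) (Complex.I • (Matrix.of A)ᴴ)
        (Complex.I • Matrix.of A) (Matrix.diagonal w)).det ^ N := by
  rw [RingHom.map_det]
  have h := Matrix.det_kronecker (1 : Matrix (Fin N) (Fin N) ℂ)
    (Matrix.fromBlocks (Matrix.diagonal z) (Complex.I • (Matrix.of A)ᴴ)
        (Complex.I • Matrix.of A) (Matrix.diagonal w))
  rw [det_one, one_pow, one_mul, Fintype.card_fin] at h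
  rw [← h]
  congr 1
  ext ⟨a, i | i⟩ ⟨b, j | j⟩ <;>
    simp only [RingHom.mapMatrix_apply, Matrix.map_apply, dualMatrix, Matrix.kronecker_apply,
      Matrix.one_apply, fromBlocks_apply₁₁, fromBlocks_apply₁₂, fromBlocks_apply₂₁,
      fromBlocks_apply₂₂, Matrix.diagonal_apply] <;>
    split_ifs <;> simp_all

lemma trace_of_mul_conjTranspose {α β : Type*} [Fintype α] [Fintype β] (J : α → β → ℂ) :
    (Matrix.of J * (Matrix.of J)ᴴ).trace = ∑ a, ∑ b, J a b * star (J a b) := by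
  simp [Matrix.trace, Matrix.mul_apply]

/-- The duality formula with unscaled Gaussian weights on both sides. -/
lemma integral_charpoly_duality (N k : ℕ) (z w : Fin k → ℂ) :
    (Real.pi : ℂ) ^ (k * k) * ∫ J : Fin N → Fin N → ℂ,
      Complex.exp (-((Matrix.of J * (Matrix.of J)ᴴ).trace)) *
        ∏ j : Fin k, ((z j • (1 : Matrix (Fin N) (Fin N) ℂ) - Matrix.of J).det *
          (w j • (1 : Matrix (Fin N) (Fin N) ℂ) - (Matrix.of J)ᴴ).det) =
    (Real.pi : ℂ) ^ (N * N) * ∫ A : Fin k → Fin k → ℂ,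
      Complex.exp (-((Matrix.of A * (Matrix.of A)ᴴ).trace)) *
        (Matrix.fromBlocks (Matrix.diagonal z) (Complex.I • (Matrix.of A)ᴴ)
          (Complex.I • Matrix.of A) (Matrix.diagonal w)).det ^ N := by
  have hJ := integral_eval_eq_gaussExp (Equiv.refl ((Fin N × Fin N) ⊕ (Fin k × Fin k)))
    (dualMatrix z w).det
  have hA := integral_eval_eq_gaussExp (Equiv.sumComm (Fin k × Fin k) (Fin N × Fin N))
    (dualMatrix z w).det
  have hswap : ∀ (f : Fin k × Fin k → ℂ) (g : Fin N × Fin N → ℂ),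
      (fun s => Sum.elim f g ((Equiv.sumComm (Fin k × Fin k) (Fin N × Fin N)).symm s)) =
        Sum.elim g f := by
    intro f g
    ext (s | s) <;> simp
  simp only [hswap, eval_det_dualMatrix_right, Fintype.card_fin] at hA
  simp only [Equiv.refl_symm, Equiv.refl_apply, Fintype.card_fin] at hJ
  simp only [eval_det_dualMatrix_left] at hJ
  simp only [trace_of_mul_conjTranspose]
  rw [hJ, hA, ← gaussExp_eq_of_laplacian_eq _ (laplacian_det_dualMatrix z w)]
  ring

/-- Duality formula for `k` pairs of characteristic polynomials in the complex Ginibre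
ensemble: an `N×N` Gaussian matrix integral equals a `k×k` matrix integral. -/
theorem statement17 (N k : ℕ) (hN : 1 ≤ N) (hk : 1 ≤ k) (z w : Fin k → ℂ) :
    (∫ J : Fin N → Fin N → ℂ,
      Complex.exp (-((Matrix.of J * (Matrix.of J)ᴴ).trace)) *
        ∏ j : Fin k,
          ((z j • (1 : Matrix (Fin N) (Fin N) ℂ) - Matrix.of J).det *
            ((starRingEnd ℂ) (w j) • (1 : Matrix (Fin N) (Fin N) ℂ) - (Matrix.of J)ᴴ).det))
      = (Real.pi : ℂ) ^ (N ^ 2) * ((N : ℂ) / (Real.pi : ℂ)) ^ (k ^ 2) *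
          ∫ A : Fin k → Fin k → ℂ,
            Complex.exp (-(N : ℂ) * (Matrix.of A * (Matrix.of A)ᴴ).trace) *
              (Matrix.fromBlocks
                (Matrix.diagonal z)
                ((Complex.I * (Real.sqrt N : ℂ)) • (Matrix.of A)ᴴ)
                ((Complex.I * (Real.sqrt N : ℂ)) • Matrix.of A)
                (Matrix.diagonal (fun j => (starRingEnd ℂ) (w j)))).det ^ N := by
  have hdual := integral_charpoly_duality N k z (fun j => (starRingEnd ℂ) (w j))
  have hHaar : (volume : Measure (Fin k → Fin k → ℂ)).IsAddHaarMeasure :=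
    Measure.pi.isAddHaarMeasure (fun _ => (volume : Measure (Fin k → ℂ)))
  have hscale := Measure.integral_comp_smul (volume : Measure (Fin k → Fin k → ℂ))
    (fun A => Complex.exp (-((Matrix.of A * (Matrix.of A)ᴴ).trace)) *
        (Matrix.fromBlocks (Matrix.diagonal z) (Complex.I • (Matrix.of A)ᴴ)
          (Complex.I • Matrix.of A)
          (Matrix.diagonal (fun j => (starRingEnd ℂ) (w j)))).det ^ N) (Real.sqrt N)
  have hsq : (Real.sqrt N : ℂ) * (Real.sqrt N : ℂ) = N := by
    rw [← Complex.ofReal_mul, Real.mul_self_sqrt N.cast_nonneg, Complex.ofReal_natCast]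
  have hdim : Module.finrank ℝ (Fin k → Fin k → ℂ) = 2 * k ^ 2 := by
    simp [Module.finrank_pi_fintype, Complex.finrank_real_complex]
    ring
  have hpow : |(Real.sqrt N ^ (2 * k ^ 2))⁻¹| = ((N : ℝ) ^ k ^ 2)⁻¹ := by
    rw [pow_mul, Real.sq_sqrt N.cast_nonneg, abs_of_nonneg (by positivity)]
  have hof : ∀ A : Fin k → Fin k → ℂ, Matrix.of (Real.sqrt N • A) =
      (Real.sqrt N : ℂ) • Matrix.of A := by
    intro A
    ext a b
    simp
  have hct : ∀ A : Fin k → Fin k → ℂ, ((Real.sqrt N : ℂ) • Matrix.of A)ᴴ =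
      (Real.sqrt N : ℂ) • (Matrix.of A)ᴴ := by
    intro A
    rw [conjTranspose_smul]
    simp
  have htr : ∀ A : Fin k → Fin k → ℂ, -(((Real.sqrt N : ℂ) • Matrix.of A) *
      ((Real.sqrt N : ℂ) • (Matrix.of A)ᴴ)).trace =
      -(N : ℂ) * (Matrix.of A * (Matrix.of A)ᴴ).trace := by
    intro A
    rw [smul_mul_smul_comm, hsq, trace_smul, smul_eq_mul, neg_mul]
  rw [hdim, hpow] at hscale
  simp only [hof, hct, htr, smul_smul] at hscale
  rw [hscale, Complex.real_smul]
  have hN0 : (N : ℂ) ≠ 0 := by exact_mod_cast (by lia : N ≠ 0)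
  have hpi : (Real.pi : ℂ) ≠ 0 := by exact_mod_cast Real.pi_ne_zero
  refine mul_left_cancel₀ (pow_ne_zero (k * k) hpi) (hdual.trans ?_)
  push_cast
  rw [div_pow]
  field_simp
  ring
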